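/- Let A be a minimal generic set on a property C of finitely generated squarefree monomial ideals of S_∞ = K[x_1, x_2, …]. Then for every J ∈ I(C) there exists I ∈ A such that μ(J) = μ(I) and H(J) ⊆ H(I), i.e., there is a bijection σ from the vertex set of H(J) to the vertex set of H(I) with σ(F) ∈ H(I) for every face F ∈ H(J). -/

import Mathlib

open CategoryTheory MvPolynomial

universe u

variable (K : Type u) [Field K]

/-- The squarefree monomial with support `A` in `K[x_0, x_1, …]`. -/
noncomputable def sqfMon (A : Finset ℕ) : MvPolynomial ℕ K :=
  ∏ i ∈ A, X i

/-- `I` is a finitely generated squarefree monomial ideal of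
`S_∞ = K[x_0, x_1, …]`. -/
def IsFGSqfMonIdeal (I : Ideal (MvPolynomial ℕ K)) : Prop :=
  ∃ 𝒜 : Finset (Finset ℕ), I = Ideal.span ((fun A => sqfMon K A) '' ↑𝒜)

/-- The supports of the minimal monomial generators `G(I)` of a squarefree
monomial ideal `I`. -/
def minSupp (I : Ideal (MvPolynomial ℕ K)) : Set (Finset ℕ) :=
  {A | sqfMon K A ∈ I ∧ ∀ B : Finset ℕ, B ⊂ A → sqfMon K B ∉ I}

/-- `μ(I)`: the number of minimal monomial generators. -/
noncomputable def muI (I : Ideal (MvPolynomial ℕ K)) : ℕ :=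
  (minSupp K I).ncard

/-- `X(I)`: the set of variables appearing in the minimal monomial
generators of `I`. -/
def varSet (I : Ideal (MvPolynomial ℕ K)) : Set ℕ :=
  ⋃ A ∈ minSupp K I, (↑A : Set ℕ)

/-- The hypergraph `H(I)`, with vertex set `G(I)` (identified with the set
`minSupp K I` of supports of minimal generators): faces are the nonempty
sets of generators divisible by a fixed variable. -/
def hypI (I : Ideal (MvPolynomial ℕ K)) : Set (Set (Finset ℕ)) :=
  {F | F.Nonempty ∧ ∃ x : ℕ, F = {A ∈ minSupp K I | x ∈ A}}

/-- The relation of Definition 5.1(2): the ideal `J` is obtained from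
`I ∈ 𝒜` by substituting pairwise coprime squarefree monomials `M x` (in the
variables `X(J)`, possibly trivial) for the variables `x ∈ X(I)`; on supports
this means a bijection `σ` of `G(I)` with `G(J)` such that the support of
`σ A` is the disjoint union of the `M x`, `x ∈ A`. -/
def Connects (I J : Ideal (MvPolynomial ℕ K)) : Prop :=
  ∃ (σ : Finset ℕ → Finset ℕ) (M : ℕ → Finset ℕ),
    Set.BijOn σ (minSupp K I) (minSupp K J) ∧
    (∀ x ∈ varSet K I, ∀ y ∈ varSet K I, x ≠ y → Disjoint (M x) (M y)) ∧
    (∀ x ∈ varSet K I, (↑(M x) : Set ℕ) ⊆ varSet K J) ∧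
    (∀ A ∈ minSupp K I, σ A = A.biUnion M)

/-- `𝒜` is a generic set on the property `C` (a set of ideals): every member
is a finitely generated squarefree monomial ideal satisfying `C`, and every
finitely generated squarefree monomial ideal satisfying `C` arises from some
member of `𝒜` by the substitution relation `Connects`. -/
def IsGenericSet (C 𝒜 : Set (Ideal (MvPolynomial ℕ K))) : Prop :=
  (∀ I ∈ 𝒜, IsFGSqfMonIdeal K I ∧ I ∈ C) ∧
  (∀ J, IsFGSqfMonIdeal K J → J ∈ C → ∃ I ∈ 𝒜, Connects K I J)

/-- A generic set is minimal if no proper subset is a generic set. -/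
def IsMinimalGenericSet (C 𝒜 : Set (Ideal (MvPolynomial ℕ K))) : Prop :=
  IsGenericSet K C 𝒜 ∧ ∀ 𝒜' ⊆ 𝒜, IsGenericSet K C 𝒜' → 𝒜' = 𝒜

/-!
Statement 11 (Proposition `claim:GenSet`(1)): if `𝒜` is a minimal generic set
on a property `C`, then for every `J ∈ 𝓘(C)` there is `I ∈ 𝒜` with
`μ(J) = μ(I)` and `H(J) ⊆ H(I)`: a bijection `σ` from the vertex set of
`H(J)` to that of `H(I)` carrying each face of `H(J)` to a face of `H(I)`.
-/

theorem minimal_generic_set_hypergraph_subset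
    (C 𝒜 : Set (Ideal (MvPolynomial ℕ K)))
    (h : IsMinimalGenericSet K C 𝒜) :
    ∀ J, IsFGSqfMonIdeal K J → J ∈ C →
      ∃ I ∈ 𝒜, muI K J = muI K I ∧
        ∃ σ : Finset ℕ → Finset ℕ,
          Set.BijOn σ (minSupp K J) (minSupp K I) ∧
          ∀ F ∈ hypI K J, σ '' F ∈ hypI K I := by
  intro J hJ hJC
  obtain ⟨I, hI, σ, M, hσ, hdisj, -, hM⟩ := h.1.2 J hJ hJC
  refine ⟨I, hI, ?_, Function.invFunOn σ (minSupp K I), hσ.symm hσ.invOn_invFunOn.symm, ?_⟩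
  · rw [muI, muI, ← hσ.image_eq, hσ.injOn.ncard_image]
  rintro F ⟨⟨B₀, hB₀⟩, x, rfl⟩
  refine ⟨⟨_, Set.mem_image_of_mem _ hB₀⟩, ?_⟩
  obtain ⟨hB₀J, hx⟩ := hB₀
  obtain ⟨A₀, hA₀, rfl⟩ := hσ.surjOn hB₀J
  rw [hM A₀ hA₀, Finset.mem_biUnion] at hx
  obtain ⟨y, hy, hxy⟩ := hx
  have mem_varSet {A : Finset ℕ} (hA : A ∈ minSupp K I) {z : ℕ} (hz : z ∈ A) :
      z ∈ varSet K I := Set.mem_biUnion hA hz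
  have mem_iff {A : Finset ℕ} (hA : A ∈ minSupp K I) : x ∈ σ A ↔ y ∈ A := by
    rw [hM A hA, Finset.mem_biUnion]
    refine ⟨?_, fun hyA => ⟨y, hyA, hxy⟩⟩
    rintro ⟨z, hz, hxz⟩
    by_contra hyA
    have hzy : z ≠ y := fun e => hyA (e ▸ hz)
    exact Finset.disjoint_left.1
      (hdisj z (mem_varSet hA hz) y (mem_varSet hA₀ hy) hzy) hxz hxy
  refine ⟨y, Set.ext fun A => ⟨?_, ?_⟩⟩
  · rintro ⟨B, ⟨hB, hxB⟩, rfl⟩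
    obtain ⟨A, hA, rfl⟩ := hσ.surjOn hB
    rw [hσ.injOn.leftInvOn_invFunOn hA]
    exact ⟨hA, (mem_iff hA).1 hxB⟩
  · rintro ⟨hA, hyA⟩
    exact ⟨σ A, ⟨hσ.mapsTo hA, (mem_iff hA).2 hyA⟩, hσ.injOn.leftInvOn_invFunOn hA⟩
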